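/- Suppose H is a [3]-graph on n ≥ 69 vertices such that every pair of non-adjacent vertices u, v satisfies d_{∂H}(u) + d_{∂H}(v) ≥ n + 65, and H contains no Hamiltonian Berge cycle. Let C be a maximal Berge cycle in H with |V(C)| ∈ {n−1, n−2, n−3} and let u ∈ V(H) − V(C). Then d_C(u) < n/4 + 18. -/

import Mathlib

/-- Two vertices are adjacent in the hypergraph with edge set `H`
if some edge contains both of them. -/
def HAdj {V : Type*} (H : Finset (Finset V)) (u v : V) : Prop :=
  u ≠ v ∧ ∃ e ∈ H, u ∈ e ∧ v ∈ e

/-- The degree of `u` in the 2-shadow `∂H`: the number of vertices adjacent to `u`. -/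
noncomputable def shadowDeg {V : Type*} (H : Finset (Finset V)) (u : V) : ℕ :=
  {v | HAdj H u v}.ncard

/-- A `[3]`-graph: every edge has exactly 2 or 3 vertices. -/
def IsThreeGraph {V : Type*} (H : Finset (Finset V)) : Prop :=
  ∀ e ∈ H, e.card = 2 ∨ e.card = 3

/-- A Berge cycle of length `t` in the hypergraph with edge set `H`:
`t` distinct vertices `vtx i` and `t` distinct edges `edge i` (indices mod `t`)
with `{vtx i, vtx (i+1)} ⊆ edge i` for every `i`. -/
structure BergeCycle {V : Type*} (H : Finset (Finset V)) (t : ℕ) where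
  vtx : ZMod t → V
  edge : ZMod t → Finset V
  vtx_inj : Function.Injective vtx
  edge_inj : Function.Injective edge
  edge_mem : ∀ i, edge i ∈ H
  mem_fst : ∀ i, vtx i ∈ edge i
  mem_snd : ∀ i, vtx (i + 1) ∈ edge i

/-- `d_C(u)`: the number of vertices of the Berge cycle `C` adjacent to `u`. -/
noncomputable def BergeCycle.dC {V : Type*} {H : Finset (Finset V)} {t : ℕ}
    (C : BergeCycle H t) (u : V) : ℕ :=
  {v | v ∈ Set.range C.vtx ∧ HAdj H u v}.ncard

/-- `H` contains a Hamiltonian Berge cycle, i.e. a Berge cycle whose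
vertex set is all of `V`. -/
def HamiltonianBergeCycle {V : Type*} (H : Finset (Finset V)) : Prop :=
  ∃ (t : ℕ) (C : BergeCycle H t), Set.range C.vtx = Set.univ

/-- A set `U` of indices of vertices of the Berge cycle `C` is usable for `u`:
(1) for every `i ∈ U` there is an edge in `E(u, v_{i-1}) - {e_{i-2}}`;
(2) any two distinct `i, j ∈ U` are non-consecutive on `C`;
(3) for every pair of distinct `i, j ∈ U` there are distinct edges
`e ∈ E(u, v_{i-1}) - {e_{i-2}}` and `e' ∈ E(u, v_{j-1}) - {e_{j-2}}`. -/
def Usable {V : Type*} {H : Finset (Finset V)} {t : ℕ} (C : BergeCycle H t) (u : V)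
    (U : Set (ZMod t)) : Prop :=
  (∀ i ∈ U, ∃ e ∈ H, e ≠ C.edge (i - 2) ∧ u ∈ e ∧ C.vtx (i - 1) ∈ e) ∧
  (∀ i ∈ U, ∀ j ∈ U, i ≠ j → j ≠ i + 1 ∧ j ≠ i - 1) ∧
  (∀ i ∈ U, ∀ j ∈ U, i ≠ j → ∃ e ∈ H, ∃ e' ∈ H, e ≠ e' ∧
    e ≠ C.edge (i - 2) ∧ u ∈ e ∧ C.vtx (i - 1) ∈ e ∧
    e' ≠ C.edge (j - 2) ∧ u ∈ e' ∧ C.vtx (j - 1) ∈ e')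

/-- `CwBtw a b c` : on the cycle oriented clockwise, `b` lies strictly between
`a` and `c` on the clockwise arc from `a` to `c`. -/
def CwBtw {t : ℕ} (a b c : ZMod t) : Prop :=
  0 < (b - a).val ∧ (b - a).val < (c - a).val

/-- `e` is an `(i,j;k)`-bridge of the Berge cycle `C`. -/
def IsBridge {V : Type*} [DecidableEq V] {H : Finset (Finset V)} {t : ℕ}
    (C : BergeCycle H t) (i j k : ZMod t) (e : Finset V) : Prop :=
  (CwBtw i k j ∧ ((e = C.edge (k + 1) ∧ e = {C.vtx i, C.vtx (k + 1), C.vtx (k + 2)}) ∨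
                (e = C.edge (k - 1) ∧ e = {C.vtx j, C.vtx k, C.vtx (k - 1)}))) ∨
  (CwBtw j k i ∧ ((e = C.edge (k - 1) ∧ e = {C.vtx i, C.vtx k, C.vtx (k - 1)}) ∨
                (e = C.edge (k + 1) ∧ e = {C.vtx j, C.vtx (k + 1), C.vtx (k + 2)})))

/-- `R(v_i, v_j)`: the set of bridges produced by the pair `{v_i, v_j}`,
i.e. all `(i,j;k)`-bridges over `k ∉ {i, j}`. -/
def RBridges {V : Type*} [DecidableEq V] {H : Finset (Finset V)} {t : ℕ}
    (C : BergeCycle H t) (i j : ZMod t) : Set (Finset V) :=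
  {e | ∃ k : ZMod t, k ≠ i ∧ k ≠ j ∧ IsBridge C i j k e}

/-- A Berge path with `L` edges. -/
structure BPath {V : Type*} (H : Finset (Finset V)) (L : ℕ) where
  x : ℕ → V
  g : ℕ → Finset V
  x_inj : ∀ p q, p ≤ L → q ≤ L → x p = x q → p = q
  g_inj : ∀ p q, p < L → q < L → g p = g q → p = q
  g_mem : ∀ p, p < L → g p ∈ H
  fst : ∀ p, p < L → x p ∈ g p
  snd : ∀ p, p < L → x (p + 1) ∈ g p

theorem BPath.close {V : Type*} {H : Finset (Finset V)} {L : ℕ} (P : BPath H L)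
    (h : Finset V) (hH : h ∈ H) (hne : ∀ p, p < L → P.g p ≠ h)
    (h0 : P.x 0 ∈ h) (hL : P.x L ∈ h) :
    ∃ C' : BergeCycle H (L + 1), ∀ p, p ≤ L → P.x p ∈ Set.range C'.vtx := by
  have hval : ∀ i : ZMod (L + 1), i.val ≤ L := fun i => Nat.lt_succ_iff.mp (ZMod.val_lt i)
  refine ⟨{ vtx := fun i => P.x i.val
            edge := fun i => if i.val < L then P.g i.val else h
            vtx_inj := ?_, edge_inj := ?_, edge_mem := ?_, mem_fst := ?_, mem_snd := ?_ }, ?_⟩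
  · intro i j hij
    exact ZMod.val_injective _ (P.x_inj _ _ (hval i) (hval j) hij)
  · intro i j hij
    apply ZMod.val_injective
    have := hval i
    have := hval j
    simp only at hij
    split_ifs at hij with h1 h2 h2
    · exact P.g_inj _ _ h1 h2 hij
    · exact absurd hij (hne _ h1)
    · exact absurd hij.symm (hne _ h2)
    · omega
  · intro i
    try simp only
    split_ifs with h1
    · exact P.g_mem _ h1
    · exact hH
  · intro i
    try simp only
    split_ifs with h1
    · exact P.fst _ h1
    · have : i.val = L := by have := hval i; omega
      rw [this]; exact hL
  · intro i
    try simp only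
    split_ifs with h1
    · have : (i + 1).val = i.val + 1 := by
        rw [ZMod.val_add, ZMod.val_one_eq_one_mod, Nat.add_mod_mod, Nat.mod_eq_of_lt]
        omega
      rw [this]; exact P.snd _ h1
    · have h2 : i.val = L := by have := hval i; omega
      have : (i + 1).val = 0 := by
        rw [ZMod.val_add, ZMod.val_one_eq_one_mod, Nat.add_mod_mod, h2, Nat.mod_self]
      rw [this]; exact h0
  · intro p hp
    refine ⟨(p : ZMod (L + 1)), ?_⟩
    try simp only
    rw [ZMod.val_natCast, Nat.mod_eq_of_lt (by omega)]

theorem BPath.rotate {V : Type*} {H : Finset (Finset V)} {L : ℕ} (P : BPath H L)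
    (p : ℕ) (hp : p < L)
    (h : Finset V) (hH : h ∈ H) (hne : ∀ q, q < L → q ≠ p → P.g q ≠ h)
    (hL : P.x L ∈ h) (hx : P.x p ∈ h) :
    ∃ P' : BPath H L, P'.x 0 = P.x 0 ∧ P'.x L = P.x (p + 1) ∧
      (∀ q, q ≤ L → ∃ q', q' ≤ L ∧ P'.x q' = P.x q) ∧
      (∀ q, q < L → P'.g q = h ∨ ∃ q', q' < L ∧ q' ≠ p ∧ P'.g q = P.g q') := by
  refine ⟨{ x := fun r => if r ≤ p then P.x r else P.x (L + p + 1 - r)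
            g := fun r => if r < p then P.g r else if r = p then h else P.g (L + p - r)
            x_inj := ?_, g_inj := ?_, g_mem := ?_, fst := ?_, snd := ?_ }, ?_, ?_, ?_, ?_⟩
  · intro r s hr hs hrs
    split_ifs at hrs with h1 h2 h2 <;>
      have := P.x_inj _ _ (by omega) (by omega) hrs <;> omega
  · intro r s hr hs hrs
    split_ifs at hrs with h1 h2 h3 h4 h5 h6 h7 h8
    · have := P.g_inj _ _ (by omega) (by omega) hrs; omega
    · exact absurd hrs (hne _ (by omega) (by omega))
    · have := P.g_inj _ _ (by omega) (by omega) hrs; omega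
    · exact absurd hrs.symm (hne _ (by omega) (by omega))
    · omega
    · exact absurd hrs.symm (hne _ (by omega) (by omega))
    · have := P.g_inj _ _ (by omega) (by omega) hrs; omega
    · exact absurd hrs (hne _ (by omega) (by omega))
    · have := P.g_inj _ _ (by omega) (by omega) hrs; omega
  · intro r hr
    split_ifs with h1 h2
    · exact P.g_mem _ hr
    · exact hH
    · exact P.g_mem _ (by omega)
  · intro r hr
    rcases lt_trichotomy r p with h1 | h1 | h1
    · rw [if_pos h1.le, if_pos h1]; exact P.fst _ hr
    · rw [if_pos h1.le, if_neg (by omega), if_pos h1, h1]; exact hx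
    · rw [if_neg (by omega), if_neg (by omega), if_neg (by omega)]
      have := P.snd (L + p - r) (by omega)
      rwa [show L + p - r + 1 = L + p + 1 - r by omega] at this
  · intro r hr
    rcases lt_trichotomy r p with h1 | h1 | h1
    · rw [if_pos (show r + 1 ≤ p by omega), if_pos h1]; exact P.snd _ hr
    · rw [if_neg (show ¬ r + 1 ≤ p by omega), if_neg (show ¬ r < p by omega), if_pos h1, h1]
      rwa [show L + p + 1 - (p + 1) = L by omega]
    · rw [if_neg (by omega), if_neg (by omega), if_neg (by omega)]
      have := P.fst (L + p - r) (by omega)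
      rwa [show L + p + 1 - (r + 1) = L + p - r by omega]
  · simp
  · simp only
    rw [if_neg (by omega)]
    congr 1; omega
  · intro q hq
    by_cases h1 : q ≤ p
    · exact ⟨q, hq, by simp only; rw [if_pos h1]⟩
    · refine ⟨L + p + 1 - q, by omega, ?_⟩
      try simp only
      rw [if_neg (by omega)]
      congr 1; omega
  · intro q hq
    try simp only
    split_ifs with h1 h2
    · exact Or.inr ⟨q, hq, by omega, rfl⟩
    · exact Or.inl rfl
    · exact Or.inr ⟨L + p - q, by omega, by omega, rfl⟩

/-- Crossing argument. -/
theorem BPath.count {V : Type*} [DecidableEq V] {H : Finset (Finset V)} {L : ℕ} (P : BPath H L)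
    (hno : ¬ ∃ C' : BergeCycle H (L + 1), ∀ p, p ≤ L → P.x p ∈ Set.range C'.vtx)
    (hna : ∀ h ∈ H, P.x 0 ∈ h → P.x L ∈ h → False)
    (A B : Finset V)
    (hA : ∀ w ∈ A, w ≠ P.x 0 ∧ (∃ p, p ≤ L ∧ P.x p = w) ∧
      ∃ h ∈ H, (∀ p, p < L → P.g p ≠ h) ∧ P.x 0 ∈ h ∧ w ∈ h)
    (hB : ∀ w ∈ B, w ≠ P.x L ∧ (∃ p, p ≤ L ∧ P.x p = w) ∧
      ∃ h ∈ H, (∀ p, p < L → P.g p ≠ h) ∧ P.x L ∈ h ∧ w ∈ h) :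
    A.card + B.card ≤ L := by
  classical
  set IA := (Finset.range L).filter (fun p => P.x (p + 1) ∈ A) with hIA
  set IB := (Finset.range L).filter (fun p => P.x p ∈ B) with hIB
  have h1 : A ⊆ IA.image (fun p => P.x (p + 1)) := by
    intro w hw
    obtain ⟨hw0, ⟨p, hp, hpw⟩, -⟩ := hA w hw
    have hp0 : p ≠ 0 := by rintro rfl; exact hw0 hpw.symm
    obtain ⟨q, rfl⟩ := Nat.exists_eq_succ_of_ne_zero hp0
    simp only [hIA, Finset.mem_image, Finset.mem_filter, Finset.mem_range]
    exact ⟨q, ⟨by omega, by simpa [← hpw] using hw⟩, hpw⟩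
  have h2 : B ⊆ IB.image P.x := by
    intro w hw
    obtain ⟨hw0, ⟨p, hp, hpw⟩, -⟩ := hB w hw
    have hp0 : p ≠ L := by rintro rfl; exact hw0 hpw.symm
    simp only [hIB, Finset.mem_image, Finset.mem_filter, Finset.mem_range]
    exact ⟨p, ⟨by omega, by rwa [hpw]⟩, hpw⟩
  have hdisj : Disjoint IA IB := by
    rw [Finset.disjoint_left]
    intro p hpA hpB
    simp only [hIA, hIB, Finset.mem_filter, Finset.mem_range] at hpA hpB
    obtain ⟨hpL, hpA⟩ := hpA
    obtain ⟨-, -, k1, hk1, hf1, h01, hw1⟩ := hA _ hpA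
    obtain ⟨-, -, k2, hk2, hf2, h02, hw2⟩ := hB _ hpB.2
    have hk : k1 ≠ k2 := by rintro rfl; exact hna _ hk1 h01 h02
    obtain ⟨P', hP0, hPL, hPc, hPg⟩ := P.rotate p hpL k2 hk2 (fun q hq _ => hf2 q hq) h02 hw2
    obtain ⟨C', hC'⟩ := P'.close k1 hk1 (by
      intro q hq heq
      rcases hPg q hq with h | ⟨q', hq', -, h⟩
      · exact hk (heq.symm.trans h)
      · exact hf1 q' hq' (h.symm.trans heq)) (by rwa [hP0]) (by rwa [hPL])
    refine hno ⟨C', fun q hq => ?_⟩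
    obtain ⟨q', hq', h⟩ := hPc q hq
    rw [← h]; exact hC' q' hq'
  have h3 : (IA ∪ IB).card ≤ L := by
    calc (IA ∪ IB).card ≤ (Finset.range L).card := Finset.card_le_card (by
          apply Finset.union_subset <;> exact Finset.filter_subset _ _)
      _ = L := Finset.card_range L
  rw [Finset.card_union_of_disjoint hdisj] at h3
  have := (Finset.card_le_card h1).trans Finset.card_image_le
  have := (Finset.card_le_card h2).trans Finset.card_image_le
  omega

theorem exists_nonbad {α : Type*} [DecidableEq α] (T : Finset α) (out : α → Finset α)
    (hout : ∀ i, (out i).card ≤ 4) (hT : 10 ≤ T.card) :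
    ∃ i ∈ T, ∃ j ∈ T, i ≠ j ∧ j ∉ out i ∧ i ∉ out j := by
  by_contra hcon
  push Not at hcon
  have h1 : T.offDiag ⊆ (T.sigma out).image (fun z => (z.1, z.2)) ∪
      (T.sigma out).image (fun z => (z.2, z.1)) := by
    rintro ⟨i, j⟩ hij
    rw [Finset.mem_offDiag] at hij
    obtain ⟨hi, hj, hne⟩ := hij
    simp only at hi hj hne
    rw [Finset.mem_union]
    by_cases h : j ∈ out i
    · left
      exact Finset.mem_image.mpr ⟨⟨i, j⟩, Finset.mem_sigma.mpr ⟨hi, h⟩, rfl⟩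
    · right
      exact Finset.mem_image.mpr ⟨⟨j, i⟩, Finset.mem_sigma.mpr ⟨hj, hcon i hi j hj hne h⟩, rfl⟩
  have h2 := Finset.card_le_card h1
  have h3 : (T.sigma out).card ≤ T.card * 4 := by
    rw [Finset.card_sigma]
    exact Finset.sum_le_card_nsmul _ _ _ (fun i _ => hout i)
  have h4 := h2.trans (Finset.card_union_le _ _)
  have h5 := Finset.card_image_le (s := T.sigma out) (f := fun z => (z.1, z.2))
  have h6 := Finset.card_image_le (s := T.sigma out) (f := fun z => (z.2, z.1))
  rw [Finset.offDiag_card] at h4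
  have h7 : T.card * 10 ≤ T.card * T.card := Nat.mul_le_mul_left _ hT
  omega

theorem card_le_three_of {V : Type*} {H : Finset (Finset V)} (h3 : IsThreeGraph H)
    {e : Finset V} (he : e ∈ H) : e.card ≤ 3 := by
  rcases h3 e he with h | h <;> omega

theorem four_false {V : Type*} [DecidableEq V] {H : Finset (Finset V)} (h3 : IsThreeGraph H)
    {e : Finset V} (he : e ∈ H) {a b c d : V} (ha : a ∈ e) (hb : b ∈ e) (hc : c ∈ e) (hd : d ∈ e)
    (hab : a ≠ b) (hac : a ≠ c) (had : a ≠ d) (hbc : b ≠ c) (hbd : b ≠ d) (hcd : c ≠ d) :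
    False := by
  have h : ({a, b, c, d} : Finset V) ⊆ e := by
    intro x hx
    simp only [Finset.mem_insert, Finset.mem_singleton] at hx
    rcases hx with rfl | rfl | rfl | rfl <;> assumption
  have h1 := Finset.card_le_card h
  have h2 := card_le_three_of h3 he
  have h4 : ({a, b, c, d} : Finset V).card = 4 := by
    rw [Finset.card_insert_of_notMem, Finset.card_insert_of_notMem,
      Finset.card_insert_of_notMem, Finset.card_singleton] <;> simp [*]
  omega

/-- The path obtained by opening the cycle just before `a` and appending `u`. -/
theorem BergeCycle.openPath {V : Type*} {H : Finset (Finset V)} {t : ℕ} [NeZero t]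
    (C : BergeCycle H t) (a : ZMod t) (u : V) (hu : u ∉ Set.range C.vtx)
    (f : Finset V) (hf : f ∈ H) (hfu : u ∈ f) (hfa : C.vtx (a - 1) ∈ f)
    (hne : ∀ k, k ≠ a - 1 → C.edge k ≠ f) :
    ∃ P : BPath H t, (∀ p, p < t → P.x p = C.vtx (a + p)) ∧ P.x t = u ∧
      (∀ p, p < t - 1 → P.g p = C.edge (a + p)) ∧ P.g (t - 1) = f := by
  have ht : 0 < t := Nat.pos_of_ne_zero (NeZero.ne t)
  have hcast : ∀ p q : ℕ, p < t → q < t → a + (p : ZMod t) = a + (q : ZMod t) → p = q := by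
    intro p q hp hq h
    have h := congrArg ZMod.val (add_left_cancel h)
    rwa [ZMod.val_natCast, ZMod.val_natCast, Nat.mod_eq_of_lt hp, Nat.mod_eq_of_lt hq] at h
  have hlast : a + ((t - 1 : ℕ) : ZMod t) = a - 1 := by
    rw [Nat.cast_sub ht]; simp [sub_eq_add_neg]
  refine ⟨{ x := fun p => if p < t then C.vtx (a + p) else u
            g := fun p => if p < t - 1 then C.edge (a + p) else f
            x_inj := ?_, g_inj := ?_, g_mem := ?_, fst := ?_, snd := ?_ }, ?_, ?_, ?_, ?_⟩
  · intro p q hp hq h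
    split_ifs at h with h1 h2 h2
    · exact hcast p q h1 h2 (C.vtx_inj h)
    · exact absurd ⟨_, h⟩ hu
    · exact absurd ⟨_, h.symm⟩ hu
    · omega
  · have hk : ∀ p : ℕ, p < t - 1 → a + (p : ZMod t) ≠ a - 1 := by
      intro p hp h
      rw [← hlast] at h
      have := hcast _ _ (by omega) (by omega) h
      omega
    intro p q hp hq h
    split_ifs at h with h1 h2 h2
    · exact hcast p q hp hq (C.edge_inj h)
    · exact absurd h (hne _ (hk p h1))
    · exact absurd h.symm (hne _ (hk q h2))
    · omega
  · intro p hp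
    split_ifs
    · exact C.edge_mem _
    · exact hf
  · intro p hp
    rw [if_pos hp]
    split_ifs with h1
    · exact C.mem_fst _
    · have : p = t - 1 := by omega
      rw [this, hlast]; exact hfa
  · intro p hp
    by_cases h1 : p < t - 1
    · rw [if_pos (show p + 1 < t by omega), if_pos h1]
      have := C.mem_snd (a + p)
      rw [Nat.cast_add, Nat.cast_one, ← add_assoc]
      exact this
    · rw [if_neg (show ¬ p + 1 < t by omega), if_neg h1]; exact hfu
  · intro p hp
    simp only
    rw [if_pos hp]
  · simp
  · intro p hp
    simp only
    rw [if_pos hp]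
  · simp

/-- The Berge path on `V(C) ∪ {u}` joining `v_a` to `v_b`. -/
theorem BergeCycle.hamPath {V : Type*} {H : Finset (Finset V)} {t : ℕ} [NeZero t]
    (C : BergeCycle H t) (a b : ZMod t) (hab : a ≠ b) (u : V) (hu : u ∉ Set.range C.vtx)
    (f f' : Finset V) (hf : f ∈ H) (hfu : u ∈ f) (hfa : C.vtx (a - 1) ∈ f)
    (hne : ∀ k, k ≠ a - 1 → C.edge k ≠ f)
    (hf' : f' ∈ H) (hfu' : u ∈ f') (hfb : C.vtx (b - 1) ∈ f')
    (hne' : ∀ k, k ≠ b - 1 → C.edge k ≠ f') (hff : f ≠ f') :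
    ∃ P : BPath H t, P.x 0 = C.vtx a ∧ P.x t = C.vtx b ∧
      (∀ w, w = u ∨ w ∈ Set.range C.vtx → ∃ p, p ≤ t ∧ P.x p = w) ∧
      (∀ p, p < t → P.g p = f ∨ P.g p = f' ∨
        ∃ k, k ≠ a - 1 ∧ k ≠ b - 1 ∧ P.g p = C.edge k) := by
  have ht : 0 < t := Nat.pos_of_ne_zero (NeZero.ne t)
  have hcast : ∀ p q : ℕ, p < t → q < t → a + (p : ZMod t) = a + (q : ZMod t) → p = q := by
    intro p q hp hq h
    have h := congrArg ZMod.val (add_left_cancel h)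
    rwa [ZMod.val_natCast, ZMod.val_natCast, Nat.mod_eq_of_lt hp, Nat.mod_eq_of_lt hq] at h
  have hlast : a + ((t - 1 : ℕ) : ZMod t) = a - 1 := by
    rw [Nat.cast_sub ht]; simp [sub_eq_add_neg]
  obtain ⟨P, hPx, hPt, hPg, hPl⟩ := C.openPath a u hu f hf hfu hfa hne
  obtain ⟨q, hq⟩ : ∃ q, (b - a).val = q + 1 := by
    apply Nat.exists_eq_succ_of_ne_zero
    rw [ne_eq, ZMod.val_eq_zero, sub_eq_zero]
    exact fun h => hab h.symm
  have hqt : q + 1 < t := hq ▸ ZMod.val_lt (b - a)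
  have hb : a + ((q + 1 : ℕ) : ZMod t) = b := by
    rw [← hq, ZMod.natCast_zmod_val]; ring
  have hb1 : a + (q : ZMod t) = b - 1 := by
    rw [← hb]; push_cast; ring
  obtain ⟨P', h0, hL, hc, hg⟩ := P.rotate q (by omega) f' hf' (by
      intro r hr hrq
      by_cases h1 : r < t - 1
      · rw [hPg r h1]
        apply hne'
        rw [← hb1]
        intro h
        exact hrq (hcast _ _ hr (by omega) h)
      · rw [show r = t - 1 by omega, hPl]; exact hff) (by rw [hPt]; exact hfu')
      (by rw [hPx q (by omega), hb1]; exact hfb)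
  refine ⟨P', ?_, ?_, ?_, ?_⟩
  · rw [h0, hPx 0 ht]; simp
  · rw [hL, hPx _ hqt, hb]
  · rintro w (rfl | ⟨k, rfl⟩)
    · obtain ⟨p, hp, h⟩ := hc t le_rfl
      exact ⟨p, hp, h.trans hPt⟩
    · have hkt := ZMod.val_lt (k - a)
      obtain ⟨p, hp, h⟩ := hc (k - a).val hkt.le
      refine ⟨p, hp, ?_⟩
      rw [h, hPx _ hkt, ZMod.natCast_zmod_val]
      congr 1; ring
  · intro p hp
    rcases hg p hp with h | ⟨r, hr, hrq, h⟩
    · exact Or.inr (Or.inl h)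
    · by_cases h1 : r < t - 1
      · right; right
        refine ⟨a + r, ?_, ?_, h.trans (hPg r h1)⟩
        · rw [← hlast]
          intro hh
          have := hcast _ _ hr (by omega) hh
          omega
        · rw [← hb1]
          intro hh
          exact hrq (hcast _ _ hr (by omega) hh)
      · left
        rw [h, show r = t - 1 by omega, hPl]

/-- Indices of cycle edges having `v_a` as the third vertex. -/
def BergeCycle.third {V : Type*} [DecidableEq V] {H : Finset (Finset V)} {t : ℕ} [NeZero t]
    (C : BergeCycle H t) (a : ZMod t) : Finset (ZMod t) :=
  Finset.univ.filter (fun k => k ≠ a ∧ k + 1 ≠ a ∧ C.vtx a ∈ C.edge k)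

theorem BergeCycle.sum_third {V : Type*} [DecidableEq V] {H : Finset (Finset V)} {t : ℕ}
    [NeZero t] (h3 : IsThreeGraph H) (ht : 1 < t)
    (C : BergeCycle H t) : ∑ a, (C.third a).card ≤ t := by
  rw [← Finset.card_sigma]
  have h1 : (Finset.univ.sigma C.third).card ≤ (Finset.univ : Finset (ZMod t)).card := by
    refine Finset.card_le_card_of_injOn (fun z => z.2) (fun _ _ => Finset.mem_coe.2 (Finset.mem_univ _)) ?_
    rintro ⟨a, k⟩ hz ⟨b, l⟩ hw hkl
    simp only [Finset.coe_sigma, Set.mem_sigma_iff, Finset.mem_coe, BergeCycle.third,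
      Finset.mem_filter] at hz hw hkl
    subst hkl
    obtain ⟨-, -, h1, h2, h4⟩ := hz
    obtain ⟨-, -, h5, h6, h7⟩ := hw
    have : a = b := by
      by_contra hab
      have : Fact (1 < t) := ⟨ht⟩
      exact four_false h3 (C.edge_mem k) (C.mem_fst k) (C.mem_snd k) h4 h7
        (fun h => by simpa using C.vtx_inj h) (fun h => h1 (C.vtx_inj h))
        (fun h => h5 (C.vtx_inj h)) (fun h => h2 (C.vtx_inj h)) (fun h => h6 (C.vtx_inj h))
        (fun h => hab (C.vtx_inj h))
    rw [this]
  simpa [ZMod.card] using h1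

theorem deg_bound {V : Type*} [Fintype V] [DecidableEq V] {H : Finset (Finset V)} {t : ℕ}
    [NeZero t] (h3 : IsThreeGraph H) (C : BergeCycle H t) (a : ZMod t) (f f' : Finset V)
    (hf : f ∈ H) (hf' : f' ∈ H) (E : Finset V → Prop)
    (hE : ∀ h, E h → h = f ∨ h = f' ∨ ∃ k, h = C.edge k) (W A : Finset V)
    (hA : ∀ w, w ≠ C.vtx a → w ∈ W → (∃ h ∈ H, ¬ E h ∧ C.vtx a ∈ h ∧ w ∈ h) → w ∈ A) :
    shadowDeg H (C.vtx a) ≤ A.card + (Wᶜ).card + 2 * (C.third a).card + 12 := by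
  set S : Finset V := A ∪ Wᶜ ∪ (C.third a).biUnion (fun k => (C.edge k).erase (C.vtx a)) ∪
    (f ∪ f' ∪ (C.edge a ∪ C.edge (a - 1))) with hS
  have hsub : {v | HAdj H (C.vtx a) v} ⊆ (S : Set V) := by
    rintro w ⟨hne, h, hh, hah, hwh⟩
    rw [Finset.mem_coe, hS]
    simp only [Finset.mem_union, Finset.mem_biUnion, Finset.mem_erase, Finset.mem_compl]
    by_cases hW : w ∈ W
    · by_cases hEh : E h
      · rcases hE h hEh with rfl | rfl | ⟨k, rfl⟩
        · tauto
        · tauto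
        · by_cases h1 : k = a
          · subst h1; tauto
          · by_cases h2 : k + 1 = a
            · have : k = a - 1 := by rw [← h2]; ring
              subst this; tauto
            · left; right
              refine ⟨k, ?_, hne.symm, hwh⟩
              simp [BergeCycle.third, h1, h2, hah]
      · left; left; left
        exact hA w hne.symm hW ⟨h, hh, hEh, hah, hwh⟩
    · tauto
  have h1 : shadowDeg H (C.vtx a) ≤ S.card := by
    unfold shadowDeg
    rw [← Set.ncard_coe_finset]
    exact Set.ncard_le_ncard hsub
  have h2 : ((C.third a).biUnion (fun k => (C.edge k).erase (C.vtx a))).card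
      ≤ (C.third a).card * 2 := by
    apply Finset.card_biUnion_le_card_mul
    intro k hk
    simp only [BergeCycle.third, Finset.mem_filter] at hk
    rw [Finset.card_erase_of_mem hk.2.2.2]
    have := card_le_three_of h3 (C.edge_mem k)
    omega
  have e1 := Finset.card_union_le (A ∪ Wᶜ ∪ (C.third a).biUnion
    (fun k => (C.edge k).erase (C.vtx a))) (f ∪ f' ∪ (C.edge a ∪ C.edge (a - 1)))
  have e2 := Finset.card_union_le (A ∪ Wᶜ) ((C.third a).biUnion
    (fun k => (C.edge k).erase (C.vtx a)))
  have e3 := Finset.card_union_le A Wᶜ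
  have e4 := Finset.card_union_le (f ∪ f') (C.edge a ∪ C.edge (a - 1))
  have e5 := Finset.card_union_le f f'
  have e6 := Finset.card_union_le (C.edge a) (C.edge (a - 1))
  have := card_le_three_of h3 hf
  have := card_le_three_of h3 hf'
  have := card_le_three_of h3 (C.edge_mem a)
  have := card_le_three_of h3 (C.edge_mem (a - 1))
  rw [hS] at h1
  omega

theorem pair_bound {V : Type*} [Fintype V] [DecidableEq V] {H : Finset (Finset V)} {t : ℕ}
    [NeZero t] (h3 : IsThreeGraph H) (ht : 1 < t) (htn : Fintype.card V ≤ t + 3)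
    (hOre : ∀ u v : V, u ≠ v → ¬ HAdj H u v →
      Fintype.card V + 65 ≤ shadowDeg H u + shadowDeg H v)
    (C : BergeCycle H t)
    (hmax : ¬ ∃ (t' : ℕ) (C' : BergeCycle H t'),
      Set.range C.vtx ⊂ Set.range C'.vtx)
    (u : V) (hu : u ∉ Set.range C.vtx)
    (a b : ZMod t) (hab : a ≠ b) (f f' : Finset V)
    (hf : f ∈ H) (hfu : u ∈ f) (hfa : C.vtx (a - 1) ∈ f)
    (hne : ∀ k, k ≠ a - 1 → C.edge k ≠ f)
    (hf' : f' ∈ H) (hfu' : u ∈ f') (hfb : C.vtx (b - 1) ∈ f')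
    (hne' : ∀ k, k ≠ b - 1 → C.edge k ≠ f') (hff : f ≠ f')
    (hb1 : C.vtx b ∉ C.edge a) (hb2 : C.vtx a ∉ C.edge b) :
    17 ≤ (C.third a).card + (C.third b).card := by
  classical
  have : Fact (1 < t) := ⟨ht⟩
  obtain ⟨P, hP0, hPt, hPc, hPg⟩ :=
    C.hamPath a b hab u hu f f' hf hfu hfa hne hf' hfu' hfb hne' hff
  have hno : ¬ ∃ C' : BergeCycle H (t + 1), ∀ p, p ≤ t → P.x p ∈ Set.range C'.vtx := by
    rintro ⟨C', hC'⟩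
    refine hmax ⟨t + 1, C', ?_⟩
    have hall : ∀ w, w = u ∨ w ∈ Set.range C.vtx → w ∈ Set.range C'.vtx := by
      intro w hw
      obtain ⟨p, hp, rfl⟩ := hPc w hw
      exact hC' p hp
    refine ⟨fun w hw => hall w (Or.inr hw), fun h => hu (h (hall u (Or.inl rfl)))⟩
  have hba : b ≠ a - 1 := by
    rintro rfl
    apply hb2
    have := C.mem_snd (a - 1)
    rwa [sub_add_cancel] at this
  have hba' : a ≠ b - 1 := by
    rintro rfl
    apply hb1
    have := C.mem_snd (b - 1)
    rwa [sub_add_cancel] at this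
  have hna : ∀ h ∈ H, C.vtx a ∈ h → C.vtx b ∈ h → False := by
    intro h hh ha hb
    by_cases hE : ∀ p, p < t → P.g p ≠ h
    · exact hno (P.close h hh hE (by rwa [hP0]) (by rwa [hPt]))
    · push Not at hE
      obtain ⟨p, hp, hph⟩ := hE
      have hvu : ∀ k, u ≠ C.vtx k := fun k hk => hu ⟨k, hk.symm⟩
      rcases hPg p hp with h1 | h1 | ⟨k, hk1, hk2, h1⟩
      · have : f = h := h1.symm.trans hph
        subst this
        exact four_false h3 hh hfu hfa ha hb (hvu _) (hvu _) (hvu _)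
          (fun h => by simpa using C.vtx_inj h) (fun h => hba (C.vtx_inj h).symm)
          (fun h => hab (C.vtx_inj h))
      · have : f' = h := h1.symm.trans hph
        subst this
        exact four_false h3 hh hfu' hfb ha hb (hvu _) (hvu _) (hvu _)
          (fun h => hba' (C.vtx_inj h).symm) (fun h => by simpa using C.vtx_inj h)
          (fun h => hab (C.vtx_inj h))
      · have : C.edge k = h := h1.symm.trans hph
        subst this
        have hka : k ≠ a := by rintro rfl; exact hb1 hb
        have hkb : k ≠ b := by rintro rfl; exact hb2 ha
        have hka' : k + 1 ≠ a := by rintro rfl; exact hk1 (by ring)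
        have hkb' : k + 1 ≠ b := by rintro rfl; exact hk2 (by ring)
        exact four_false h3 hh (C.mem_fst k) (C.mem_snd k) ha hb
          (fun h => by simpa using C.vtx_inj h) (fun h => hka (C.vtx_inj h))
          (fun h => hkb (C.vtx_inj h)) (fun h => hka' (C.vtx_inj h))
          (fun h => hkb' (C.vtx_inj h)) (fun h => hab (C.vtx_inj h))
  set E : Finset V → Prop := fun h => ∃ p, p < t ∧ P.g p = h with hEdef
  have hE : ∀ h, E h → h = f ∨ h = f' ∨ ∃ k, h = C.edge k := by
    rintro h ⟨p, hp, rfl⟩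
    rcases hPg p hp with h1 | h1 | ⟨k, -, -, h1⟩
    · exact Or.inl h1
    · exact Or.inr (Or.inl h1)
    · exact Or.inr (Or.inr ⟨k, h1⟩)
  set W : Finset V := insert u (Finset.univ.image C.vtx) with hW
  have hWcard : W.card = t + 1 := by
    rw [hW, Finset.card_insert_of_notMem, Finset.card_image_of_injective _ C.vtx_inj]
    · simp [ZMod.card]
    · simpa using hu
  have hWc : (Wᶜ).card = Fintype.card V - (t + 1) := by rw [Finset.card_compl, hWcard]
  have hWle : W.card ≤ Fintype.card V := Finset.card_le_univ W
  have hWP : ∀ w ∈ W, ∃ p, p ≤ t ∧ P.x p = w := by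
    intro w hw
    apply hPc
    simpa [hW] using hw
  set A : ZMod t → Finset V := fun c => Finset.univ.filter
    (fun w => w ≠ C.vtx c ∧ w ∈ W ∧ ∃ h ∈ H, ¬ E h ∧ C.vtx c ∈ h ∧ w ∈ h) with hA
  have hAd : ∀ c, shadowDeg H (C.vtx c) ≤
      (A c).card + (Wᶜ).card + 2 * (C.third c).card + 12 := by
    intro c
    apply deg_bound h3 C c f f' hf hf' E hE
    intro w h1 h2 h4
    simp only [hA, Finset.mem_filter, Finset.mem_univ, true_and]
    exact ⟨h1, h2, h4⟩
  have hAP : ∀ c, ∀ w ∈ A c, w ≠ C.vtx c ∧ (∃ p, p ≤ t ∧ P.x p = w) ∧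
      ∃ h ∈ H, (∀ p, p < t → P.g p ≠ h) ∧ C.vtx c ∈ h ∧ w ∈ h := by
    intro c w hw
    simp only [hA, Finset.mem_filter, Finset.mem_univ, true_and] at hw
    obtain ⟨h1, h2, h, hh, h4, h5⟩ := hw
    exact ⟨h1, hWP w h2, h, hh, fun p hp hph => h4 ⟨p, hp, hph⟩, h5⟩
  have hcount := P.count hno (by rw [hP0, hPt]; exact hna) (A a) (A b)
    (by rw [hP0]; exact hAP a) (by rw [hPt]; exact hAP b)
  have hore := hOre (C.vtx a) (C.vtx b) (fun h => hab (C.vtx_inj h)) (by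
    rintro ⟨-, h, hh, h1, h2⟩
    exact hna h hh h1 h2)
  have := hAd a
  have := hAd b
  omega

/-- Lemma 5(d): every vertex `u` off a maximal Berge cycle `C`
with `|V(C)| ∈ {n-1, n-2, n-3}` satisfies `d_C(u) < n/4 + 18`. -/
theorem stmt11 {V : Type*} [Fintype V] [DecidableEq V] (n : ℕ) (hn : 69 ≤ n)
    (hcard : Fintype.card V = n) (H : Finset (Finset V)) (h3 : IsThreeGraph H)
    (hOre : ∀ u v : V, u ≠ v → ¬ HAdj H u v →
      n + 65 ≤ shadowDeg H u + shadowDeg H v)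
    (hnoham : ¬ HamiltonianBergeCycle H)
    {t : ℕ} (C : BergeCycle H t)
    (hmax : ¬ ∃ (t' : ℕ) (C' : BergeCycle H t'),
      Set.range C.vtx ⊂ Set.range C'.vtx)
    (ht : t = n - 1 ∨ t = n - 2 ∨ t = n - 3)
    (u : V) (hu : u ∉ Set.range C.vtx) :
    (C.dC u : ℚ) < (n : ℚ) / 4 + 18 := by
  classical
  by_contra hcon
  push Not at hcon
  have ht1 : 66 ≤ t := by omega
  have htn : n ≤ t + 3 := by omega
  have htn' : t < n := by omega
  have : NeZero t := ⟨by omega⟩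
  have : Fact (1 < t) := ⟨by omega⟩
  have hd : n + 72 ≤ 4 * C.dC u := by
    have : (n : ℚ) + 72 ≤ 4 * (C.dC u : ℚ) := by linarith
    exact_mod_cast this
  -- good indices
  set Q : ZMod t → Finset V → Prop := fun k f =>
    f ∈ H ∧ u ∈ f ∧ C.vtx k ∈ f ∧ f ≠ C.edge (k - 1) with hQ
  set S : Finset (ZMod t) := Finset.univ.filter (fun k => ∃ f, Q k f) with hS
  have hDS : C.dC u ≤ 2 * S.card := by
    have hsub : {v | v ∈ Set.range C.vtx ∧ HAdj H u v} ⊆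
        ((S.image C.vtx ∪ S.image (fun k => C.vtx (k + 1)) : Finset V) : Set V) := by
      rintro _ ⟨⟨k, rfl⟩, -, f, hf, huf, hkf⟩
      rw [Finset.mem_coe, Finset.mem_union, Finset.mem_image, Finset.mem_image]
      by_cases h : f = C.edge (k - 1)
      · right
        refine ⟨k - 1, ?_, by rw [sub_add_cancel]⟩
        simp only [hS, Finset.mem_filter, Finset.mem_univ, true_and]
        refine ⟨f, hf, huf, ?_, ?_⟩
        · rw [h]; exact C.mem_fst _
        · rw [h]; intro hh
          exact one_ne_zero (sub_eq_self.mp (C.edge_inj hh).symm)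
      · left
        refine ⟨k, ?_, rfl⟩
        simp only [hS, Finset.mem_filter, Finset.mem_univ, true_and]
        exact ⟨f, hf, huf, hkf, h⟩
    have h1 : C.dC u ≤ (S.image C.vtx ∪ S.image (fun k => C.vtx (k + 1))).card := by
      unfold BergeCycle.dC
      rw [← Set.ncard_coe_finset]
      exact Set.ncard_le_ncard hsub
    have h2 := Finset.card_union_le (S.image C.vtx) (S.image (fun k => C.vtx (k + 1)))
    have h4 := Finset.card_image_le (s := S) (f := C.vtx)
    have h5 := Finset.card_image_le (s := S) (f := fun k => C.vtx (k + 1))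
    omega
  have hSf : ∀ k, ∃ f, k ∈ S → Q k f := by
    intro k
    by_cases hk : k ∈ S
    · obtain ⟨f, hf⟩ := (Finset.mem_filter.mp hk).2
      exact ⟨f, fun _ => hf⟩
    · exact ⟨∅, fun h => absurd h hk⟩
  choose F hF using hSf
  -- low indices
  set T : Finset (ZMod t) := S.filter (fun k => (C.third (k + 1)).card ≤ 8) with hT
  have hTcard : 10 ≤ T.card := by
    have h1 := Finset.card_filter_add_card_filter_not (s := S)
      (fun k => (C.third (k + 1)).card ≤ 8)
    have h2 : (S.filter (fun k => ¬ (C.third (k + 1)).card ≤ 8)).card * 9 ≤ t := by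
      calc (S.filter (fun k => ¬ (C.third (k + 1)).card ≤ 8)).card * 9
          ≤ ∑ k ∈ S.filter (fun k => ¬ (C.third (k + 1)).card ≤ 8), (C.third (k + 1)).card := by
            rw [← smul_eq_mul]
            apply Finset.card_nsmul_le_sum
            intro k hk
            have := (Finset.mem_filter.mp hk).2
            omega
        _ ≤ ∑ k, (C.third (k + 1)).card :=
            Finset.sum_le_univ_sum_of_nonneg (fun _ => Nat.zero_le _)
        _ = ∑ k, (C.third k).card :=
            Equiv.sum_comp (Equiv.addRight (1 : ZMod t)) (fun k => (C.third k).card)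
        _ ≤ t := C.sum_third h3 (by omega)
    rw [← hT] at h1
    omega
  set out : ZMod t → Finset (ZMod t) := fun i =>
    if i ∈ S then
      Finset.univ.filter (fun j => C.vtx j ∈ (F i).erase (C.vtx i)) ∪
      Finset.univ.filter (fun j => C.vtx (j + 1) ∈ (C.edge (i + 1)).erase (C.vtx (i + 1)))
    else ∅ with hout
  have hout4 : ∀ i, (out i).card ≤ 4 := by
    intro i
    simp only [hout]
    split_ifs with hi
    · obtain ⟨q1, q2, q3, q4⟩ := hF i hi
      have h1 : (Finset.univ.filter (fun j => C.vtx j ∈ (F i).erase (C.vtx i))).card ≤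
          ((F i).erase (C.vtx i)).card := by
        apply Finset.card_le_card_of_injOn C.vtx
        · intro j hj
          exact Finset.mem_coe.2 (Finset.mem_filter.mp hj).2
        · intro j _ k _ h
          exact C.vtx_inj h
      have h2 : (Finset.univ.filter (fun j => C.vtx (j + 1) ∈
          (C.edge (i + 1)).erase (C.vtx (i + 1)))).card ≤
          ((C.edge (i + 1)).erase (C.vtx (i + 1))).card := by
        apply Finset.card_le_card_of_injOn (fun j => C.vtx (j + 1))
        · intro j hj
          exact Finset.mem_coe.2 (Finset.mem_filter.mp hj).2
        · intro j _ k _ h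
          exact add_right_cancel (C.vtx_inj h)
      rw [Finset.card_erase_of_mem q3] at h1
      rw [Finset.card_erase_of_mem (C.mem_fst _)] at h2
      have := card_le_three_of h3 q1
      have := card_le_three_of h3 (C.edge_mem (i + 1))
      have := Finset.card_union_le
        (Finset.univ.filter (fun j => C.vtx j ∈ (F i).erase (C.vtx i)))
        (Finset.univ.filter (fun j => C.vtx (j + 1) ∈
          (C.edge (i + 1)).erase (C.vtx (i + 1))))
      omega
    · simp
  obtain ⟨i, hi, j, hj, hij, hji, hij'⟩ := exists_nonbad T out hout4 hTcard
  obtain ⟨hiS, hi8⟩ := Finset.mem_filter.mp hi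
  obtain ⟨hjS, hj8⟩ := Finset.mem_filter.mp hj
  have hiF := hF i hiS
  have hjF := hF j hjS
  simp only [hout, if_pos hiS, Finset.mem_union, Finset.mem_filter, Finset.mem_univ, true_and,
    Finset.mem_erase, not_or, not_and] at hji
  simp only [hout, if_pos hjS, Finset.mem_union, Finset.mem_filter, Finset.mem_univ, true_and,
    Finset.mem_erase, not_or, not_and] at hij'
  have hgood : ∀ k f, Q k f → ∀ l, l ≠ k → C.edge l ≠ f := by
    rintro k f ⟨q1, q2, q3, q4⟩ l hl rfl
    have hlk : l + 1 ≠ k := by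
      rintro rfl
      exact q4 (by rw [add_sub_cancel_right])
    exact four_false h3 q1 q2 (C.mem_fst l) (C.mem_snd l) q3 (fun h => hu ⟨_, h.symm⟩)
      (fun h => hu ⟨_, h.symm⟩) (fun h => hu ⟨_, h.symm⟩)
      (fun h => by simpa using C.vtx_inj h) (fun h => hl (C.vtx_inj h))
      (fun h => hlk (C.vtx_inj h))
  have hij1 : i + 1 ≠ j + 1 := fun h => hij (add_right_cancel h)
  have hfin := pair_bound h3 (by omega) (by omega) (by rw [hcard]; exact hOre) C hmax u hu
    (i + 1) (j + 1) hij1 (F i) (F j) hiF.1 hiF.2.1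
    (by rw [add_sub_cancel_right]; exact hiF.2.2.1)
    (by rw [add_sub_cancel_right]; exact hgood i _ hiF) hjF.1 hjF.2.1
    (by rw [add_sub_cancel_right]; exact hjF.2.2.1)
    (by rw [add_sub_cancel_right]; exact hgood j _ hjF)
    (by
      intro h
      apply hji.1 (fun hh => hij (C.vtx_inj hh).symm)
      rw [h]; exact hjF.2.2.1)
    (hji.2 (fun hh => hij1 (C.vtx_inj hh).symm))
    (hij'.2 (fun hh => hij1 (C.vtx_inj hh)))
  omega
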